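/- The group PSL_2(11) has no solvable 11-complement; that is, there is no solvable subgroup H of PSL_2(11) whose index in PSL_2(11) is a power of 11 and whose order is relatively prime to 11. -/

import Mathlib

open Matrix
open scoped MatrixGroups

section Solvable

variable {G : Type*} [Group G]

/-- A nontrivial solvable group has a nontrivial normal abelian subgroup. -/
theorem exists_normal_isMulCommutative_ne_bot [Group.IsSolvable G] [Nontrivial G] :
    ∃ A : Subgroup G, A.Normal ∧ A ≠ ⊥ ∧ ∀ a ∈ A, ∀ b ∈ A, a * b = b * a := by
  classical
  have hG : ∃ n, derivedSeries G n = ⊥ := Group.IsSolvable.solvable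
  have hpos : Nat.find hG ≠ 0 := by
    intro h
    have := Nat.find_spec hG
    rw [h, derivedSeries_zero] at this
    exact top_ne_bot this
  obtain ⟨n, hn⟩ := Nat.exists_eq_succ_of_ne_zero hpos
  refine ⟨derivedSeries G n, derivedSeries_normal G n, Nat.find_min hG (by omega), ?_⟩
  have h := Nat.find_spec hG
  rw [hn, derivedSeries_succ] at h
  intro a ha b hb
  exact commutatorElement_eq_one_iff_mul_comm.1
    ((Subgroup.mem_bot).1 (h ▸ Subgroup.commutator_mem_commutator ha hb))

/-- A nontrivial finite solvable group has a nontrivial normal `p`-subgroup for some prime `p`. -/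
theorem exists_normal_isPGroup_ne_bot [Finite G] [Group.IsSolvable G] [Nontrivial G] :
    ∃ (p : ℕ) (N : Subgroup G), p.Prime ∧ N.Normal ∧ N ≠ ⊥ ∧ IsPGroup p N := by
  obtain ⟨A, hA, hne, hcomm⟩ := exists_normal_isMulCommutative_ne_bot (G := G)
  have hcard : Nat.card A ≠ 1 := fun h ↦ hne (Subgroup.card_eq_one.1 h)
  obtain ⟨p, hp, hdvd⟩ := Nat.exists_prime_and_dvd hcard
  have := Fact.mk hp
  let P : Sylow p A := default
  have hP : (P : Subgroup A).Normal := ⟨fun n hn g ↦ by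
    have : g * n = n * g := Subtype.ext (hcomm g g.2 n n.2)
    rwa [this, mul_inv_cancel_right]⟩
  have := P.characteristic_of_normal hP
  refine ⟨p, (P : Subgroup A).map A.subtype, hp, inferInstance, ?_, P.isPGroup'.map _⟩
  rw [Ne, Subgroup.map_eq_bot_iff_of_injective _ A.subtype_injective]
  exact P.ne_bot_of_dvd_card hdvd

/-- An element of prime order `q` centralizes a nontrivial element of every finite normal subgroup
whose order is not congruent to `1` modulo `q`. -/
theorem exists_commute_ne_one_of_normal {q : ℕ} [Fact q.Prime] {x : G} (hx : orderOf x = q)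
    (N : Subgroup G) [N.Normal] [Finite N] (hN : ¬ Nat.card N ≡ 1 [MOD q]) :
    ∃ y ∈ N, y ≠ 1 ∧ Commute x y := by
  let : MulAction (Subgroup.zpowers x) N :=
    MulAction.compHom N ((MulAut.conjNormal (H := N)).comp (Subgroup.zpowers x).subtype)
  have hq : IsPGroup q (Subgroup.zpowers x) :=
    IsPGroup.of_card (n := 1) (by rw [Nat.card_zpowers, hx, pow_one])
  by_contra! hcon
  refine hN ((hq.card_modEq_card_fixedPoints N).trans ?_)
  have hfix : MulAction.fixedPoints (Subgroup.zpowers x) N = {1} := by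
    ext y
    have hsmul (g : Subgroup.zpowers x) : ((g • y : N) : G) = g * y * (g : G)⁻¹ :=
      MulAut.conjNormal_apply (H := N) g.1 y
    constructor
    · intro hy
      by_contra hne
      refine hcon y y.2 (fun h ↦ hne (Subtype.ext h)) ?_
      have h := hsmul ⟨x, Subgroup.mem_zpowers x⟩
      rw [hy] at h
      exact (eq_mul_inv_iff_mul_eq.1 h).symm
    · rintro rfl g
      exact Subtype.ext (by simp [hsmul])
  rw [hfix]
  simp [Nat.ModEq]

/-- In a solvable group of order `60`, some element of order `5` commutes with an element of
order `2` or `3`. -/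
theorem exists_commute_of_isSolvable_of_card_eq_sixty [Group.IsSolvable G] (hG : Nat.card G = 60) :
    ∃ x y : G, x ^ 5 = 1 ∧ x ≠ 1 ∧ (y ^ 2 = 1 ∨ y ^ 3 = 1) ∧ y ≠ 1 ∧ Commute x y := by
  have : Finite G := Nat.finite_of_card_ne_zero (by omega)
  have : Nontrivial G := Finite.one_lt_card_iff_nontrivial.1 (by omega)
  obtain ⟨p, N, hp, hN, hne, hpN⟩ := exists_normal_isPGroup_ne_bot (G := G)
  have := Fact.mk hp
  obtain ⟨k, hk⟩ := IsPGroup.iff_card.1 hpN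
  have hk0 : k ≠ 0 := by
    rintro rfl
    exact hne (Subgroup.card_eq_one.1 (by simpa using hk))
  have hdvd : p ^ k ∣ 60 := hk ▸ hG ▸ N.card_subgroup_dvd_card
  have hp60 : p ∣ 60 := (dvd_pow_self p hk0).trans hdvd
  have hpcases : p = 2 ∨ p = 3 ∨ p = 5 := by
    rw [show 60 = 2 * 2 * 3 * 5 by rfl, hp.dvd_mul, hp.dvd_mul, hp.dvd_mul,
      Nat.prime_dvd_prime_iff_eq hp Nat.prime_two, Nat.prime_dvd_prime_iff_eq hp Nat.prime_three,
      Nat.prime_dvd_prime_iff_eq hp Nat.prime_five] at hp60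
    tauto
  by_cases h5 : p = 5
  · subst h5
    have hk1 : k = 1 := by
      by_contra hk1
      have : 5 ^ 2 ∣ 60 := (pow_dvd_pow 5 (by omega)).trans hdvd
      omega
    subst hk1
    have := Fact.mk Nat.prime_three
    obtain ⟨y, hy⟩ := exists_prime_orderOf_dvd_card' (G := G) 3 (by omega)
    obtain ⟨x, hxN, hx1, hxy⟩ := exists_commute_ne_one_of_normal hy N (by rw [hk]; decide)
    refine ⟨x, y, ?_, hx1, Or.inr (hy ▸ pow_orderOf_eq_one y), ?_, hxy.symm⟩
    · have h := congrArg Subtype.val (pow_card_eq_one' (x := (⟨x, hxN⟩ : N)))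
      simpa [hk] using h
    · rintro rfl
      simp at hy
  · have := Fact.mk Nat.prime_five
    obtain ⟨x, hx⟩ := exists_prime_orderOf_dvd_card' (G := G) 5 (by omega)
    have hmod : ¬ Nat.card N ≡ 1 [MOD 5] := by
      rw [hk]
      intro h
      have hle := Nat.le_of_dvd (by norm_num) hdvd
      have hk6 : k < 6 := by
        by_contra! hk6
        have h1 := Nat.pow_le_pow_right hp.pos hk6
        have h2 := Nat.pow_le_pow_left hp.two_le 6
        omega
      rcases hpcases with rfl | rfl | rfl
      · interval_cases k <;> revert h hdvd hk0 <;> decide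
      · interval_cases k <;> revert h hdvd hk0 <;> decide
      · exact h5 rfl
    obtain ⟨y, hyN, hy1, hxy⟩ := exists_commute_ne_one_of_normal hx N hmod
    obtain ⟨j, hj⟩ := IsPGroup.iff_orderOf.1 hpN ⟨y, hyN⟩
    rw [Subgroup.orderOf_mk] at hj
    have hx1 : x ≠ 1 := by
      rintro rfl
      simp at hx
    have hj0 : j ≠ 0 := by
      rintro rfl
      exact hy1 (orderOf_eq_one_iff.1 (by simpa using hj))
    have hord : orderOf (y ^ p ^ (j - 1)) = p := by
      rw [orderOf_pow_of_dvd (pow_ne_zero _ hp.ne_zero) (hj ▸ pow_dvd_pow p (by omega)), hj,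
        Nat.pow_div (by omega) hp.pos]
      simp [show j - (j - 1) = 1 by omega]
    refine ⟨x, y ^ p ^ (j - 1), hx ▸ pow_orderOf_eq_one x, hx1, ?_, ?_, hxy.pow_right _⟩
    · have hpow := pow_orderOf_eq_one (y ^ p ^ (j - 1))
      rw [hord] at hpow
      rcases hpcases with rfl | rfl | rfl
      · exact Or.inl hpow
      · exact Or.inr hpow
      · exact absurd rfl h5
    · intro h
      rw [h, orderOf_one] at hord
      exact hp.one_lt.ne hord

end Solvable

/-- The order of `SL n F` times the order of `Fˣ` is the order of `GL n F`. -/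
theorem Matrix.SpecialLinearGroup.card_mul_card_units {n F : Type*} [DecidableEq n] [Fintype n]
    [Nonempty n] [Field F] :
    Nat.card (Matrix.SpecialLinearGroup n F) * Nat.card Fˣ = Nat.card (GL n F) := by
  have hrange : (Matrix.SpecialLinearGroup.toGL : Matrix.SpecialLinearGroup n F →* GL n F).range =
      (GeneralLinearGroup.det : GL n F →* Fˣ).ker := by
    ext g
    constructor
    · rintro ⟨A, rfl⟩
      exact Units.ext A.det_coe
    · intro hg
      exact ⟨⟨g, congrArg Units.val hg⟩, Units.ext rfl⟩
  have hinj : Function.Injective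
      (Matrix.SpecialLinearGroup.toGL : Matrix.SpecialLinearGroup n F →* GL n F) :=
    fun A B h ↦ Subtype.ext (congrArg Units.val h)
  rw [Nat.card_congr (MonoidHom.ofInjective hinj).toEquiv, hrange,
    ← Nat.card_congr (QuotientGroup.quotientKerEquivOfSurjective
      (GeneralLinearGroup.det : GL n F →* Fˣ) GeneralLinearGroup.det_surjective).toEquiv, mul_comm,
    ← Subgroup.card_eq_card_quotient_mul_card_subgroup]

instance : Fact (Nat.Prime 11) := ⟨by norm_num⟩

theorem card_SL_two_zmod_eleven : Nat.card SL(2, ZMod 11) = 1320 := by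
  have h := Matrix.SpecialLinearGroup.card_mul_card_units (n := Fin 2) (F := ZMod 11)
  rw [card_GL_field] at h
  simp [Fin.prod_univ_two, ZMod.card_units_eq_totient, Nat.totient_prime (p := 11) Fact.out] at h
  rw [Nat.card_eq_fintype_card]
  omega

theorem card_center_SL_two_zmod_eleven :
    Nat.card (Subgroup.center SL(2, ZMod 11)) = 2 := by
  rw [Nat.card_congr (Matrix.SpecialLinearGroup.center_equiv_rootsOfUnity' (0 : Fin 2)).toEquiv]
  exact (IsPrimitiveRoot.neg_one 11 (by norm_num)).card_rootsOfUnity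

theorem card_PSL_two_zmod_eleven : Nat.card PSL(2, ZMod 11) = 660 := by
  have h := (Subgroup.center SL(2, ZMod 11)).card_eq_card_quotient_mul_card_subgroup
  rw [card_SL_two_zmod_eleven, card_center_SL_two_zmod_eleven] at h
  exact Nat.eq_of_mul_eq_mul_right two_pos h.symm

/-- A central element of `SL(2, R)` is characterized by its entries. -/
theorem mem_center_SL_two_iff {R : Type*} [CommRing R] (A : SL(2, R)) :
    A ∈ Subgroup.center SL(2, R) ↔ A 0 1 = 0 ∧ A 1 0 = 0 ∧ A 0 0 = A 1 1 := by
  have hdet := A.det_coe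
  rw [det_fin_two] at hdet
  rw [Matrix.SpecialLinearGroup.mem_center_iff]
  constructor
  · rintro ⟨r, -, hr⟩
    simp [← hr]
  · rintro ⟨hb, hc, had⟩
    refine ⟨A 0 0, ?_, ?_⟩
    · rw [hb, ← had] at hdet
      simpa [sq] using hdet
    · ext i j
      fin_cases i <;> fin_cases j <;> simp [hb, hc, had]

section

variable {A B : SL(2, ZMod 11)}

/-- The trace of an element of `SL(2, 11)` whose image in `PSL(2, 11)` has order `2` or `3`. -/
theorem trace_of_pow_two_or_three_mem_center (hA : A ∉ Subgroup.center SL(2, ZMod 11))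
    (h : A ^ 2 ∈ Subgroup.center SL(2, ZMod 11) ∨ A ^ 3 ∈ Subgroup.center SL(2, ZMod 11)) :
    A 0 0 + A 1 1 = 0 ∨ (A 0 0 + A 1 1) ^ 2 = 1 := by
  have hdet := A.det_coe
  rw [det_fin_two] at hdet
  simp only [mem_center_SL_two_iff, pow_succ, pow_zero, one_mul, Matrix.SpecialLinearGroup.coe_mul,
    mul_apply, Fin.sum_univ_two] at hA h
  grind

/-- The trace of an element of `SL(2, 11)` whose image in `PSL(2, 11)` has order `5`. -/
theorem trace_of_pow_five_mem_center (hB : B ∉ Subgroup.center SL(2, ZMod 11))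
    (h : B ^ 5 ∈ Subgroup.center SL(2, ZMod 11)) :
    (B 0 0 + B 1 1) ^ 4 - 3 * (B 0 0 + B 1 1) ^ 2 + 1 = 0 := by
  have hdet := B.det_coe
  rw [det_fin_two] at hdet
  simp only [mem_center_SL_two_iff, pow_succ, pow_zero, one_mul, Matrix.SpecialLinearGroup.coe_mul,
    mul_apply, Fin.sum_univ_two] at hB h
  grind

/-- Elements of `SL(2, 11)` whose images in `PSL(2, 11)` commute, where the image of `A` has
order `2` or `3`, do not map to an element of order `5`. -/
theorem not_commute_mk_of_pow_mem_center (hA : A ∉ Subgroup.center SL(2, ZMod 11))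
    (hApow : A ^ 2 ∈ Subgroup.center SL(2, ZMod 11) ∨ A ^ 3 ∈ Subgroup.center SL(2, ZMod 11))
    (hB : B ∉ Subgroup.center SL(2, ZMod 11)) (hBpow : B ^ 5 ∈ Subgroup.center SL(2, ZMod 11)) :
    ¬ Commute (A : PSL(2, ZMod 11)) B := by
  intro hcomm
  have hmem : (A * B)⁻¹ * (B * A) ∈ Subgroup.center SL(2, ZMod 11) := QuotientGroup.eq.1 hcomm
  obtain ⟨r, hr, hr'⟩ := Matrix.SpecialLinearGroup.mem_center_iff.1 hmem
  have hBA : (B : Matrix (Fin 2) (Fin 2) (ZMod 11)) * A = A * B * Matrix.scalar (Fin 2) r := by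
    rw [hr', ← Matrix.SpecialLinearGroup.coe_mul, ← Matrix.SpecialLinearGroup.coe_mul,
      ← Matrix.SpecialLinearGroup.coe_mul, mul_inv_cancel_left]
  have htA := trace_of_pow_two_or_three_mem_center hA hApow
  have htB := trace_of_pow_five_mem_center hB hBpow
  have hdA := A.det_coe
  have hdB := B.det_coe
  rw [det_fin_two] at hdA hdB
  have h00 := congrFun₂ hBA 0 0
  have h01 := congrFun₂ hBA 0 1
  have h10 := congrFun₂ hBA 1 0
  have h11 := congrFun₂ hBA 1 1
  simp [mul_apply, Fin.sum_univ_two] at h00 h01 h10 h11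
  generalize A 0 0 = a, A 0 1 = b, A 1 0 = c, A 1 1 = d at *
  generalize B 0 0 = e, B 0 1 = f, B 1 0 = g, B 1 1 = h at *
  have hr1 : r = 1 ∨ r = -1 := sq_eq_one_iff.1 (by simpa using hr)
  rcases hr1 with rfl | rfl
  · have hc : c ≠ 0 := by
      rintro rfl
      have key : ∀ a d : ZMod 11, a * d = 1 → ¬ (a + d = 0 ∨ (a + d) ^ 2 = 1) := by decide
      exact key a d (by simpa using hdA) htA
    have hdisc : (g / c) ^ 2 * ((a + d) ^ 2 - 4) = (e + h) ^ 2 - 4 := by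
      have hgc : c * (e - h) = g * (a - d) := by linear_combination -h10
      have hbf : b * g = c * f := by linear_combination -h00
      field_simp
      grind
    have key : ∀ w t s : ZMod 11, (t = 0 ∨ t ^ 2 = 1) → s ^ 4 - 3 * s ^ 2 + 1 = 0 →
        w ^ 2 * (t ^ 2 - 4) ≠ s ^ 2 - 4 := by decide
    exact key _ _ _ htA htB hdisc
  · have htr : e + h = 0 := by
      grind
    rw [htr] at htB
    revert htB
    decide

end

/-- The group `PSL₂(11)` has no solvable `11`-complement: there is no solvable subgroup
whose index is a power of `11` and whose order is coprime to `11`. -/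
theorem psl2_11_no_solvable_11_complement :
    ¬ ∃ H : Subgroup (PSL(2, ZMod 11)), IsSolvable H ∧
      (∃ k : ℕ, H.index = 11 ^ k) ∧ Nat.Coprime (Nat.card H) 11 := by
  rintro ⟨H, hH, ⟨k, hk⟩, hcop⟩
  have hcard : Nat.card H * 11 ^ k = 60 * 11 := by
    rw [← hk, H.card_mul_index, card_PSL_two_zmod_eleven]
  have hH60 : Nat.card H = 60 := by
    refine Nat.dvd_antisymm (hcop.dvd_of_dvd_mul_right (Dvd.intro _ hcard)) ?_
    exact (Nat.Coprime.pow_right k (by decide : Nat.Coprime 60 11)).dvd_of_dvd_mul_right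
      (Dvd.intro _ hcard.symm)
  have : Group.IsSolvable H := hH
  obtain ⟨x, y, hx5, hx1, hy, hy1, hxy⟩ := exists_commute_of_isSolvable_of_card_eq_sixty hH60
  obtain ⟨B, hB⟩ := QuotientGroup.mk_surjective (x : PSL(2, ZMod 11))
  obtain ⟨A, hA⟩ := QuotientGroup.mk_surjective (y : PSL(2, ZMod 11))
  refine not_commute_mk_of_pow_mem_center (A := A) (B := B) ?_ ?_ ?_ ?_ ?_
  · rw [← QuotientGroup.eq_one_iff, hA]
    exact_mod_cast hy1
  · rw [← QuotientGroup.eq_one_iff, ← QuotientGroup.eq_one_iff, QuotientGroup.mk_pow,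
      QuotientGroup.mk_pow, hA]
    exact_mod_cast hy
  · rw [← QuotientGroup.eq_one_iff, hB]
    exact_mod_cast hx1
  · rw [← QuotientGroup.eq_one_iff, QuotientGroup.mk_pow, hB]
    exact_mod_cast hx5
  · rw [hA, hB]
    exact congrArg Subtype.val hxy.symm.eq
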